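/- arXiv:1512.04070 — 8 statements merged into one kernel-verified Lean document; each statement's English description precedes it below -/
import Mathlib

section
/- Let a < b and let f : [a,b] → ℝ be the affine fractal function defined by a system S = {S₁,...,S_m} of affine maps S_i(x,y) = (p_i x + h_i, q_i y + r_i x + s_i) with 0 < |p_i| < 1 and 0 < |q_i| < 1. Suppose the projected system S^◊ does not satisfy the weak separation property, i.e. there exists a sequence (g_n) of elements of the associated family F^◊, each distinct from the identity, whose linear coefficients converge to 1 and whose constant coefficients converge to 0. Then there exist real constants A, B, C such that f(x) = A x² + B x + C for all x ∈ [a,b] (the graph of f is a segment of a parabola, possibly degenerate). -/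
open Set Filter

/-- Composition `c ∘ d` of affine maps of `ℝ` represented by coefficient pairs
`(p, h)` acting as `x ↦ p·x + h`. -/
def affComp (c d : ℝ × ℝ) : ℝ × ℝ := (c.1 * d.1, c.1 * d.2 + c.2)

/-- Coefficients of the composition `S^◊_{i₁} ∘ ⋯ ∘ S^◊_{i_k}` of the projected maps
`S^◊_i(x) = pᵢ·x + hᵢ`, for a word `w = [i₁, …, i_k]`.  Nonempty words enumerate the
semigroup `G^◊` generated by `S^◊`. -/
def wordCoeff {m : ℕ} (p h : Fin m → ℝ) : List (Fin m) → ℝ × ℝ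
  | [] => (1, 0)
  | i :: w => affComp (p i, h i) (wordCoeff p h w)

open Topology

section Words

variable {m : ℕ} {a b : ℝ} {p h q r s : Fin m → ℝ} {f : ℝ → ℝ}

theorem wordCoeff_functional_equation (hq : ∀ i, q i ≠ 0)
    (hS : ∀ i, ∀ x ∈ Icc a b, p i * x + h i ∈ Icc a b ∧
      f (p i * x + h i) = q i * f x + r i * x + s i) (w : List (Fin m)) :
    ∃ Q R S : ℝ, Q ≠ 0 ∧ ∀ x ∈ Icc a b,
      (wordCoeff p h w).1 * x + (wordCoeff p h w).2 ∈ Icc a b ∧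
      f ((wordCoeff p h w).1 * x + (wordCoeff p h w).2) = Q * f x + R * x + S := by
  induction w with
  | nil => exact ⟨1, 0, 0, one_ne_zero, fun x hx => by simpa [wordCoeff] using hx⟩
  | cons i w ih =>
    obtain ⟨Q, R, S, hQ, hw⟩ := ih
    refine ⟨q i * Q, q i * R + r i * (wordCoeff p h w).1,
      q i * S + r i * (wordCoeff p h w).2 + s i, mul_ne_zero (hq i) hQ, fun x hx => ?_⟩
    obtain ⟨hmem, heq⟩ := hw x hx
    obtain ⟨hmem', heq'⟩ := hS i _ hmem
    have harg : (wordCoeff p h (i :: w)).1 * x + (wordCoeff p h (i :: w)).2 =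
        p i * ((wordCoeff p h w).1 * x + (wordCoeff p h w).2) + h i := by
      simp only [wordCoeff, affComp]; ring
    rw [harg]
    refine ⟨hmem', ?_⟩
    rw [heq', heq]; ring

theorem exists_wordCoeff_abs_le {ρ : ℝ} (hρ : ∀ i, |p i| ≤ ρ)
    (hcov : ∀ y ∈ Icc a b, ∃ i, ∃ x ∈ Icc a b, y = p i * x + h i) (n : ℕ) :
    ∀ y ∈ Icc a b, ∃ w : List (Fin m), |(wordCoeff p h w).1| ≤ ρ ^ n ∧
      ∃ x ∈ Icc a b, y = (wordCoeff p h w).1 * x + (wordCoeff p h w).2 := by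
  induction n with
  | zero => exact fun y hy => ⟨[], by simp [wordCoeff], y, hy, by simp [wordCoeff]⟩
  | succ n ih =>
    intro y hy
    obtain ⟨i, x, hx, rfl⟩ := hcov y hy
    obtain ⟨w, hw, z, hz, rfl⟩ := ih x hx
    refine ⟨i :: w, ?_, z, hz, ?_⟩
    · simp only [wordCoeff, affComp, abs_mul, pow_succ']
      exact mul_le_mul (hρ i) hw (abs_nonneg _) ((abs_nonneg _).trans (hρ i))
    · simp only [wordCoeff, affComp]; ring

/-- Every point of `[a, b]` lies in arbitrarily small images of `[a, b]` under `G^◊`. -/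
theorem exists_wordCoeff_small (hp : ∀ i, |p i| < 1)
    (hcov : ∀ y ∈ Icc a b, ∃ i, ∃ x ∈ Icc a b, y = p i * x + h i)
    {y : ℝ} (hy : y ∈ Icc a b) {ε : ℝ} (hε : 0 < ε) :
    ∃ w : List (Fin m), ∀ x ∈ Icc a b,
      |(wordCoeff p h w).1 * x + (wordCoeff p h w).2 - y| < ε := by
  obtain ⟨ρ, hρ0, hρ1, hρ⟩ : ∃ ρ : ℝ, 0 ≤ ρ ∧ ρ < 1 ∧ ∀ i, |p i| ≤ ρ := by
    obtain ⟨i₀, -⟩ := hcov y hy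
    have : Nonempty (Fin m) := ⟨i₀⟩
    obtain ⟨i, hi⟩ := Finite.exists_max fun i => |p i|
    exact ⟨|p i|, abs_nonneg _, hp i, hi⟩
  have hlim : Tendsto (fun n : ℕ => ρ ^ n * (b - a)) atTop (𝓝 0) := by
    simpa using (tendsto_pow_atTop_nhds_zero_of_lt_one hρ0 hρ1).mul_const (b - a)
  obtain ⟨n, hn⟩ := (hlim.eventually_lt_const hε).exists
  obtain ⟨w, hw, z, hz, rfl⟩ := exists_wordCoeff_abs_le hρ hcov n y hy
  refine ⟨w, fun x hx => lt_of_le_of_lt ?_ hn⟩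
  rw [show (wordCoeff p h w).1 * x + (wordCoeff p h w).2 -
    ((wordCoeff p h w).1 * z + (wordCoeff p h w).2) = (wordCoeff p h w).1 * (x - z) by ring,
    abs_mul]
  refine mul_le_mul hw ?_ (abs_nonneg _) (pow_nonneg hρ0 n)
  rw [abs_le]
  constructor <;> linarith [hx.1, hx.2, hz.1, hz.2]

end Words

theorem continuousOn_of_isCompact_graphOn {f : ℝ → ℝ} {K : Set ℝ}
    (hK : IsCompact {pt : ℝ × ℝ | ∃ x ∈ K, pt = (x, f x)}) : ContinuousOn f K := by
  rw [continuousOn_iff_isClosed]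
  intro t ht
  have himage := ((hK.inter_right (ht.preimage continuous_snd)).image continuous_fst).isClosed
  refine ⟨_, himage, ?_⟩
  ext x
  constructor
  · rintro ⟨hxt, hxK⟩
    exact ⟨⟨(x, f x), ⟨⟨x, hxK, rfl⟩, hxt⟩, rfl⟩, hxK⟩
  · rintro ⟨⟨_, ⟨⟨z, -, rfl⟩, hzt⟩, rfl⟩, hxK⟩
    exact ⟨hzt, hxK⟩

/-- An affine functional equation of `f` along a near-identity map, integrated. -/
theorem primitive_functional_equation {f F : ℝ → ℝ} (hF : ∀ x, HasDerivAt F (f x) x)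
    {c d u v Q R S : ℝ}
    (hf : ∀ x ∈ Icc c d, f (x + (u * x + v)) = f x + Q * f x + R * x + S) :
    ∀ x ∈ Icc c d, F (x + (u * x + v)) - F x - (F (c + (u * c + v)) - F c) =
      u * (F x - F c) +
        (1 + u) * (Q * (F x - F c) + R * ((x ^ 2 - c ^ 2) / 2) + S * (x - c)) := by
  let D : ℝ → ℝ := fun x => F (x + (u * x + v)) -
    (1 + u) * ((1 + Q) * F x + R * (x ^ 2 / 2) + S * x)
  have hD : ∀ x, HasDerivAt D (f (x + (u * x + v)) * (1 + u) -
      (1 + u) * ((1 + Q) * f x + R * x + S)) x := by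
    intro x
    have h1 : HasDerivAt (fun x : ℝ => x + (u * x + v)) (1 + u) x := by
      simpa using (hasDerivAt_id' x).fun_add (((hasDerivAt_id' x).const_mul u).add_const v)
    have h2 : HasDerivAt (fun x : ℝ => x ^ 2 / 2) x x := by
      simpa using ((hasDerivAt_id x).pow 2).div_const 2
    have h3 : HasDerivAt (fun x : ℝ => S * x) S x := by
      simpa using (hasDerivAt_id x).const_mul S
    exact ((hF _).comp x h1).sub
      (((((hF x).const_mul (1 + Q)).add (h2.const_mul R)).add h3).const_mul (1 + u))
  have hconst := constant_of_has_deriv_right_zero (f := D) (a := c) (b := d)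
    (fun x _ => (hD x).continuousAt.continuousWithinAt) fun x hx => by
      have := (hD x).hasDerivWithinAt (s := Ici x)
      rw [hf x ⟨hx.1, hx.2.le⟩] at this
      convert this using 1
      ring
  intro x hx
  have := hconst x hx
  simp only [D] at this
  linear_combination this

/-- If `f` satisfies affine functional equations along nontrivial affine maps converging to the
identity, then the primitive `F` of `f` satisfies a nontrivial linear differential equation. -/
theorem exists_linear_equation_of_tendsto_id {f F : ℝ → ℝ} (hF : ∀ x, HasDerivAt F (f x) x)
    {c d : ℝ} {u v Q R S : ℕ → ℝ}
    (hu : Tendsto u atTop (𝓝 0)) (hv : Tendsto v atTop (𝓝 0))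
    (hne : ∀ n, u n ≠ 0 ∨ v n ≠ 0)
    (hf : ∀ n, ∀ x ∈ Icc c d,
      f (x + (u n * x + v n)) = f x + Q n * f x + R n * x + S n) :
    ∃ α β A r s k : ℝ, (α ≠ 0 ∨ β ≠ 0 ∨ A ≠ 0 ∨ r ≠ 0 ∨ s ≠ 0) ∧
      ∀ x ∈ Icc c d, (α * x + β) * f x = k + A * F x + r * (x ^ 2 / 2) + s * x := by
  let V : ℕ → Fin 5 → ℝ := fun n => ![u n, v n, Q n, R n, S n]
  have hV : ∀ n, V n ≠ 0 := by
    intro n h0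
    have h1 : u n = 0 := congrFun h0 0
    have h2 : v n = 0 := congrFun h0 1
    exact (hne n).elim (· h1) (· h2)
  obtain ⟨L, hL, φ, hφ, hlim⟩ := (isCompact_sphere (0 : Fin 5 → ℝ) 1).tendsto_subseq
    (x := fun n => ‖V n‖⁻¹ • V n) fun n => by
      rw [mem_sphere_zero_iff_norm, norm_smul, norm_inv, norm_norm,
        inv_mul_cancel₀ (norm_ne_zero_iff.2 (hV n))]
  rw [tendsto_pi_nhds] at hlim
  let e : ℕ → ℝ := fun n => ‖V (φ n)‖⁻¹
  have l0 : Tendsto (fun n => e n * u (φ n)) atTop (𝓝 (L 0)) := hlim 0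
  have l1 : Tendsto (fun n => e n * v (φ n)) atTop (𝓝 (L 1)) := hlim 1
  have l2 : Tendsto (fun n => e n * Q (φ n)) atTop (𝓝 (L 2)) := hlim 2
  have l3 : Tendsto (fun n => e n * R (φ n)) atTop (𝓝 (L 3)) := hlim 3
  have l4 : Tendsto (fun n => e n * S (φ n)) atTop (𝓝 (L 4)) := hlim 4
  have hu' := hu.comp hφ.tendsto_atTop
  have hv' := hv.comp hφ.tendsto_atTop
  have hdiff : ∀ x, Tendsto (fun n => e n * (F (x + (u (φ n) * x + v (φ n))) - F x)) atTop
      (𝓝 ((L 0 * x + L 1) * f x)) := by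
    intro x
    have hd : Tendsto (fun n => u (φ n) * x + v (φ n)) atTop (𝓝 0) := by
      simpa using (hu'.mul_const x).add hv'
    have hed : Tendsto (fun n => e n • (u (φ n) * x + v (φ n))) atTop
        (𝓝 (L 0 * x + L 1)) := by
      refine ((l0.mul_const x).add l1).congr fun n => ?_
      rw [smul_eq_mul]; ring
    simpa using (hF x).hasFDerivAt.hasFDerivWithinAt (s := univ) |>.lim hd
      (.of_forall fun _ => mem_univ _) hed
  have hL0 : L ≠ 0 := by
    rintro rfl
    simp at hL
  refine ⟨L 0, L 1, L 0 + L 2, L 3, L 4, (L 0 * c + L 1) * f c -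
    (L 0 + L 2) * F c - L 3 * (c ^ 2 / 2) - L 4 * c, ?_, fun x hx => ?_⟩
  · by_contra! hall
    obtain ⟨h0, h1, h2, h3, h4⟩ := hall
    apply hL0
    ext i
    fin_cases i <;> simp_all
  · have hl := (hdiff x).sub (hdiff c)
    have hone : Tendsto (fun n => 1 + u (φ n)) atTop (𝓝 (1 + 0)) := hu'.const_add 1
    have hr := (l0.mul_const (F x - F c)).add (hone.mul
      (((l2.mul_const (F x - F c)).add (l3.mul_const ((x ^ 2 - c ^ 2) / 2))).add
        (l4.mul_const (x - c))))
    have heq := tendsto_nhds_unique (hl.congr fun n => ?_) hr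
    · linear_combination heq
    · linear_combination e n * primitive_functional_equation hF (hf (φ n)) x hx

theorem contDiffOn_primitive_of_linear_equation {f F : ℝ → ℝ} (hF : ∀ x, HasDerivAt F (f x) x)
    {U : Set ℝ} (hU : IsOpen U) {α β A r s k : ℝ} (hne : ∀ x ∈ U, α * x + β ≠ 0)
    (heq : ∀ x ∈ U, (α * x + β) * f x = k + A * F x + r * (x ^ 2 / 2) + s * x) (n : ℕ) :
    ContDiffOn ℝ n F U ∧ ContDiffOn ℝ n f U := by
  have hf : ∀ n : ℕ, ContDiffOn ℝ n F U → ContDiffOn ℝ n f U := by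
    intro n hn
    have : ContDiffOn ℝ n
        (fun x => (k + A * F x + r * (x ^ 2 / 2) + s * x) / (α * x + β)) U :=
      ContDiffOn.div (by fun_prop) (by fun_prop) hne
    refine this.congr fun x hx => ?_
    rw [eq_div_iff (hne x hx), ← heq x hx, mul_comm]
  have hFn : ContDiffOn ℝ n F U := by
    induction n with
    | zero =>
      exact contDiffOn_zero.2 fun x _ => (hF x).continuousAt.continuousWithinAt
    | succ n ih =>
      push_cast
      rw [contDiffOn_succ_iff_deriv_of_isOpen hU]
      refine ⟨fun x _ => (hF x).differentiableAt.differentiableWithinAt, by simp, ?_⟩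
      rw [show deriv F = f from funext fun x => (hF x).deriv]
      exact hf n ih
  exact ⟨hFn, hf n hFn⟩

/-- A nontrivial linear differential equation forces smoothness on some subinterval. -/
theorem exists_contDiffOn_of_linear_equation {f F : ℝ → ℝ} (hF : ∀ x, HasDerivAt F (f x) x)
    {c d : ℝ} (hcd : c < d) {α β A r s k : ℝ}
    (hne : α ≠ 0 ∨ β ≠ 0 ∨ A ≠ 0 ∨ r ≠ 0 ∨ s ≠ 0)
    (heq : ∀ x ∈ Icc c d, (α * x + β) * f x = k + A * F x + r * (x ^ 2 / 2) + s * x) :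
    ∃ c' d' : ℝ, c ≤ c' ∧ c' < d' ∧ d' ≤ d ∧ ∀ n : ℕ, ContDiffOn ℝ n f (Ioo c' d') := by
  have key : ∀ c' d' : ℝ, c ≤ c' → d' ≤ d → (∀ x ∈ Ioo c' d', α * x + β ≠ 0) →
      ∀ n : ℕ, ContDiffOn ℝ n f (Ioo c' d') := fun c' d' hc hd hx n =>
    (contDiffOn_primitive_of_linear_equation hF isOpen_Ioo hx
      (fun x hx => heq x ⟨hc.trans hx.1.le, hx.2.le.trans hd⟩) n).2
  by_cases hα : α = 0
  · by_cases hβ : β = 0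
    · subst hα hβ
      have hlin : ∀ x ∈ Ioo c d, A * f x + r * x + s = 0 := by
        intro x hx
        have h2 : HasDerivAt (fun x : ℝ => x ^ 2 / 2) x x := by
          simpa using ((hasDerivAt_id x).pow 2).div_const 2
        have h3 : HasDerivAt (fun x : ℝ => s * x) s x := by
          simpa using (hasDerivAt_id x).const_mul s
        have h4 := ((((hF x).const_mul A).const_add k).add (h2.const_mul r)).add h3
        refine h4.unique ((hasDerivAt_const x (0 : ℝ)).congr_of_eventuallyEq ?_)
        filter_upwards [isOpen_Ioo.mem_nhds hx] with y hy
        simpa using (heq y ⟨hy.1.le, hy.2.le⟩).symm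
      have hA : A ≠ 0 := by
        rintro rfl
        have e1 := hlin ((c + d) / 2) ⟨by linarith, by linarith⟩
        have e2 := hlin ((c + 2 * d) / 3) ⟨by linarith, by linarith⟩
        have hr : r = 0 := by
          have : r * (d - c) = 0 := by linarith
          exact (mul_eq_zero.1 this).resolve_right (by linarith)
        subst hr
        have hs : s = 0 := by linarith
        simp [hs] at hne
      refine ⟨c, d, le_rfl, hcd, le_rfl, fun n => ?_⟩
      have : ContDiffOn ℝ n (fun x => -(r * x + s) / A) (Ioo c d) := by fun_prop
      refine this.congr fun x hx => ?_
      rw [eq_div_iff hA]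
      linarith [hlin x hx]
    · exact ⟨c, d, le_rfl, hcd, le_rfl, key c d le_rfl le_rfl fun x _ => by simpa [hα] using hβ⟩
  · have hroot : ∀ x, α * x + β = 0 → x = -β / α := fun x hx => by
      rw [eq_div_iff hα]; linarith
    rcases le_total (-β / α) ((c + d) / 2) with hz | hz
    · exact ⟨(c + d) / 2, d, by linarith, by linarith, le_rfl,
        key _ _ (by linarith) le_rfl fun x hx h0 => by linarith [hroot x h0, hx.1]⟩
    · exact ⟨c, (c + d) / 2, le_rfl, by linarith, by linarith,
        key _ _ le_rfl (by linarith) fun x hx h0 => by linarith [hroot x h0, hx.2]⟩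

theorem eq_add_of_hasDerivWithinAt_eq {a b : ℝ} {φ ψ φ' : ℝ → ℝ}
    (hφ : ∀ x ∈ Icc a b, HasDerivWithinAt φ (φ' x) (Icc a b) x)
    (hψ : ∀ x ∈ Icc a b, HasDerivWithinAt ψ (φ' x) (Icc a b) x) :
    ∀ x ∈ Icc a b, φ x = ψ x + (φ a - ψ a) := by
  have hd : ∀ x ∈ Icc a b, HasDerivWithinAt (fun x => φ x - ψ x) 0 (Icc a b) x := fun x hx => by
    simpa using (hφ x hx).fun_sub (hψ x hx)
  intro x hx
  have := constant_of_has_deriv_right_zero (f := fun x => φ x - ψ x)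
    (fun x hx => (hd x hx).continuousWithinAt)
    (fun x hx => (hd x (Ico_subset_Icc_self hx)).mono_of_mem_nhdsWithin
      (Icc_mem_nhdsGE_of_mem hx)) x hx
  linarith

/-- Differentiating a self-affine functional equation. -/
theorem deriv_functional_equation {a b : ℝ} (hab : a < b) {φ φ' l : ℝ → ℝ} {p h c q : ℝ}
    (hφ : ∀ x ∈ Icc a b, HasDerivWithinAt φ (φ' x) (Icc a b) x)
    (hmaps : ∀ x ∈ Icc a b, p * x + h ∈ Icc a b)
    (heq : ∀ x ∈ Icc a b, c * φ (p * x + h) = q * φ x + l x)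
    {l' : ℝ → ℝ} (hl : ∀ x, HasDerivAt l (l' x) x) :
    ∀ x ∈ Icc a b, c * p * φ' (p * x + h) = q * φ' x + l' x := by
  intro x hx
  have h1 : HasDerivWithinAt (fun x : ℝ => p * x + h) p (Icc a b) x := by
    simpa using (((hasDerivAt_id x).const_mul p).add_const h).hasDerivWithinAt
  have h2 := ((hφ _ (hmaps x hx)).comp x h1 hmaps).const_mul c
  have h3 : HasDerivWithinAt (fun x => c * φ (p * x + h)) (q * φ' x + l' x) (Icc a b) x :=
    (((hφ x hx).const_mul q).fun_add (hl x).hasDerivWithinAt).congr heq (heq x hx)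
  have := (uniqueDiffOn_Icc hab x hx).eq_deriv _ h2 h3
  linear_combination this

/-- A smooth function with a self-affine graph is a quadratic polynomial. -/
theorem quadratic_of_contDiffOn {m : ℕ} {a b : ℝ} (hab : a < b) {p h q r s : Fin m → ℝ}
    (hp : ∀ i, p i ≠ 0 ∧ |p i| < 1) (hq : ∀ i, q i ≠ 0) {f : ℝ → ℝ}
    (hS : ∀ i, ∀ x ∈ Icc a b, p i * x + h i ∈ Icc a b ∧
      f (p i * x + h i) = q i * f x + r i * x + s i)
    (hcov : ∀ y ∈ Icc a b, ∃ i, ∃ x ∈ Icc a b, y = p i * x + h i)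
    (hf : ∀ n : ℕ, ContDiffOn ℝ n f (Icc a b)) :
    ∃ A B C : ℝ, ∀ x ∈ Icc a b, f x = A * x ^ 2 + B * x + C := by
  obtain ⟨φ, hφ0, hφ⟩ : ∃ φ : ℕ → ℝ → ℝ, φ 0 = f ∧ ∀ n, ∀ x ∈ Icc a b,
      HasDerivWithinAt (φ n) (φ (n + 1) x) (Icc a b) x := by
    refine ⟨fun n => iteratedDerivWithin n f (Icc a b), iteratedDerivWithin_zero, fun n x hx => ?_⟩
    simp only [iteratedDerivWithin_succ]
    exact ((hf (n + 1)).differentiableOn_iteratedDerivWithin (by exact_mod_cast n.lt_succ_self)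
      (uniqueDiffOn_Icc hab) x hx).hasDerivWithinAt
  have hmaps : ∀ i, ∀ x ∈ Icc a b, p i * x + h i ∈ Icc a b := fun i x hx => (hS i x hx).1
  have hφeq : ∀ k i, ∀ x ∈ Icc a b,
      p i ^ (k + 2) * φ (k + 2) (p i * x + h i) = q i * φ (k + 2) x := by
    intro k i
    induction k with
    | zero =>
      have h0 : ∀ x ∈ Icc a b, 1 * φ 0 (p i * x + h i) = q i * φ 0 x + (r i * x + s i) := by
        intro x hx
        rw [hφ0, (hS i x hx).2]; ring
      have h1 := deriv_functional_equation hab (hφ 0) (hmaps i) h0 (l' := fun _ => r i)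
        fun x => by simpa using ((hasDerivAt_id x).const_mul (r i)).add_const (s i)
      have h2 := deriv_functional_equation hab (hφ 1) (hmaps i) h1 (l' := fun _ => 0)
        fun x => hasDerivAt_const _ _
      intro x hx
      linear_combination h2 x hx
    | succ k ih =>
      have h1 := deriv_functional_equation hab (hφ (k + 2)) (hmaps i) (l := fun _ => 0)
        (fun x hx => by rw [ih x hx, add_zero]) (l' := fun _ => 0) fun x => hasDerivAt_const _ _
      intro x hx
      linear_combination h1 x hx
  have ha : a ∈ Icc a b := left_mem_Icc.2 hab.le
  have hhigh : ∃ K, ∀ x ∈ Icc a b, φ (K + 3) x = 0 := by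
    have hev : ∀ᶠ n : ℕ in atTop, ∀ i, |p i| ^ n < |q i| := eventually_all.2 fun i =>
      (tendsto_pow_atTop_nhds_zero_of_lt_one (abs_nonneg _) (hp i).2).eventually_lt_const
        (abs_pos.2 (hq i))
    obtain ⟨K, hK⟩ := ((tendsto_add_atTop_nat 3).eventually hev).exists
    refine ⟨K, ?_⟩
    have hcont : ContinuousOn (φ (K + 3)) (Icc a b) :=
      fun x hx => (hφ _ x hx).continuousWithinAt
    obtain ⟨y, hy, hmax⟩ := isCompact_Icc.exists_isMaxOn ⟨a, ha⟩ hcont.abs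
    obtain ⟨i, -⟩ := hcov a ha
    have hle : |φ (K + 3) (p i * y + h i)| ≤ |φ (K + 3) y| := hmax (hmaps i y hy)
    have heq := congrArg abs (hφeq (K + 1) i y hy)
    rw [abs_mul, abs_mul, abs_pow] at heq
    have hy0 : |φ (K + 3) y| = 0 := by
      have h1 : |p i| ^ (K + 3) * |φ (K + 3) (p i * y + h i)| ≤
          |p i| ^ (K + 3) * |φ (K + 3) y| := by gcongr
      have h2 : |p i| ^ (K + 3) * |φ (K + 3) (p i * y + h i)| = |q i| * |φ (K + 3) y| := heq
      nlinarith [hK i, abs_nonneg (φ (K + 3) y)]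
    intro x hx
    have : |φ (K + 3) x| ≤ |φ (K + 3) y| := hmax hx
    exact abs_nonpos_iff.1 (this.trans_eq hy0)
  have hpoly : ∀ n (κ : ℝ), (∀ x ∈ Icc a b, φ (n + 1) x = κ) →
      ∃ μ, ∀ x ∈ Icc a b, φ n x = κ * x + μ := by
    intro n κ hκ
    refine ⟨_, eq_add_of_hasDerivWithinAt_eq (hφ n) (ψ := fun x => κ * x) fun x hx => ?_⟩
    rw [hκ x hx]
    simpa using ((hasDerivAt_id x).const_mul κ).hasDerivWithinAt
  have hdown : ∀ k, (∀ x ∈ Icc a b, φ (k + 4) x = 0) → ∀ x ∈ Icc a b, φ (k + 3) x = 0 := by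
    intro k hk
    obtain ⟨κ, hκ⟩ := hpoly (k + 3) 0 hk
    simp only [zero_mul, zero_add] at hκ
    obtain ⟨μ, hμ⟩ := hpoly (k + 2) κ hκ
    by_contra! hne
    obtain ⟨x₀, hx₀, hne⟩ := hne
    rw [hκ x₀ hx₀] at hne
    have hfix : ∀ i x, κ * (p i * x + h i) + μ = p i * (κ * x + μ) := by
      intro i x
      have e3 := hφeq (k + 1) i a ha
      rw [hκ _ (hmaps i a ha), hκ a ha] at e3
      have hqp : q i = p i ^ (k + 3) := (mul_right_cancel₀ hne e3).symm
      have e2 := hφeq k i a ha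
      rw [hμ _ (hmaps i a ha), hμ a ha, hqp] at e2
      have : p i ^ (k + 2) * (κ * (p i * a + h i) + μ) =
          p i ^ (k + 2) * (p i * (κ * a + μ)) := by rw [e2]; ring
      linear_combination mul_left_cancel₀ (pow_ne_zero _ (hp i).1) this
    have hcont : ContinuousOn (fun x => |κ * x + μ|) (Icc a b) := by fun_prop
    obtain ⟨y, hy, hmax⟩ := isCompact_Icc.exists_isMaxOn ⟨a, ha⟩ hcont
    obtain ⟨i, z, hz, rfl⟩ := hcov y hy
    have hmax' : ∀ x ∈ Icc a b, |κ * x + μ| ≤ |p i| * |κ * z + μ| := fun x hx => by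
      rw [← abs_mul, ← hfix]; exact hmax hx
    have hz0 : |κ * z + μ| = 0 := by
      nlinarith [hmax' z hz, (hp i).2, abs_nonneg (κ * z + μ)]
    have hzero : ∀ x ∈ Icc a b, κ * x + μ = 0 := fun x hx =>
      abs_nonpos_iff.1 (by simpa [hz0] using hmax' x hx)
    have hκab : κ * (b - a) = 0 := by
      linear_combination hzero b (right_mem_Icc.2 hab.le) - hzero a ha
    exact (mul_ne_zero hne (by linarith)) hκab
  have hthree : ∀ x ∈ Icc a b, φ 3 x = 0 := by
    obtain ⟨K, hK⟩ := hhigh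
    induction K with
    | zero => exact hK
    | succ K ih => exact ih (hdown K hK)
  obtain ⟨κ, hκ⟩ := hpoly 2 0 hthree
  simp only [zero_mul, zero_add] at hκ
  obtain ⟨μ, hμ⟩ := hpoly 1 κ hκ
  refine ⟨κ / 2, μ, φ 0 a - (κ / 2 * a ^ 2 + μ * a), fun x hx => ?_⟩
  rw [← hφ0]
  refine eq_add_of_hasDerivWithinAt_eq (hφ 0) (ψ := fun x => κ / 2 * x ^ 2 + μ * x)
    (fun x hx => ?_) x hx
  rw [zero_add, hμ x hx, show κ * x + μ = κ / 2 * (2 * x) + μ by ring]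
  have h1 : HasDerivAt (fun x : ℝ => κ / 2 * x ^ 2 + μ * x) (κ / 2 * (2 * x) + μ) x := by
    simpa using (((hasDerivAt_id' x).fun_pow 2).const_mul (κ / 2)).fun_add
      ((hasDerivAt_id' x).const_mul μ)
  exact h1.hasDerivWithinAt

/-- **Theorem 3 (main theorem).**  Let `f` be the affine fractal function on `[a,b]`
defined by a system `S = {S₁, …, S_m}`, `Sᵢ(x,y) = (pᵢ·x + hᵢ, qᵢ·y + rᵢ·x + sᵢ)`,
`0 < |pᵢ| < 1`, `0 < |qᵢ| < 1` (its graph is a compact set invariant under `S`).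
If the projected system `S^◊` fails the weak separation property — i.e. some sequence
of elements `gₙ ≠ Id` of the associated family `F^◊ = (G^◊)⁻¹ ∘ G^◊` (each `gₙ` being
the affine map `(p, h)`, with `g^◊_v ∘ gₙ = g^◊_u` for some nonempty words `u, v`)
converges coefficientwise to the identity — then the graph of `f` is a segment of a
(possibly degenerate) parabola. -/
theorem fractal_function_is_parabola {m : ℕ} (a b : ℝ) (hab : a < b)
    (p h q r s : Fin m → ℝ)
    (hp : ∀ i, 0 < |p i| ∧ |p i| < 1) (hq : ∀ i, 0 < |q i| ∧ |q i| < 1)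
    (f : ℝ → ℝ)
    (hcompact : IsCompact {pt : ℝ × ℝ | ∃ x ∈ Icc a b, pt = (x, f x)})
    (hattr : {pt : ℝ × ℝ | ∃ x ∈ Icc a b, pt = (x, f x)} =
      ⋃ i : Fin m,
        (fun pt : ℝ × ℝ => (p i * pt.1 + h i, q i * pt.2 + r i * pt.1 + s i)) ''
          {pt : ℝ × ℝ | ∃ x ∈ Icc a b, pt = (x, f x)})
    (g : ℕ → ℝ × ℝ)
    (hgF : ∀ n, ∃ u v : List (Fin m), u ≠ [] ∧ v ≠ [] ∧
      affComp (wordCoeff p h v) (g n) = wordCoeff p h u)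
    (hgne : ∀ n, g n ≠ (1, 0))
    (hglin : Tendsto (fun n => (g n).1) atTop (nhds 1))
    (hgconst : Tendsto (fun n => (g n).2) atTop (nhds 0)) :
    ∃ A B C : ℝ, ∀ x ∈ Icc a b, f x = A * x ^ 2 + B * x + C := by
  have hp0 : ∀ i, p i ≠ 0 := fun i => abs_pos.1 (hp i).1
  have hq0 : ∀ i, q i ≠ 0 := fun i => abs_pos.1 (hq i).1
  have hS : ∀ i, ∀ x ∈ Icc a b, p i * x + h i ∈ Icc a b ∧
      f (p i * x + h i) = q i * f x + r i * x + s i := by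
    intro i x hx
    have hmem : (p i * x + h i, q i * f x + r i * x + s i) ∈
        {pt : ℝ × ℝ | ∃ x ∈ Icc a b, pt = (x, f x)} := by
      rw [hattr]
      exact mem_iUnion.2 ⟨i, (x, f x), ⟨x, hx, rfl⟩, rfl⟩
    obtain ⟨y, hy, hxy⟩ := hmem
    obtain ⟨rfl, h2⟩ := Prod.mk.inj hxy
    exact ⟨hy, h2.symm⟩
  have hcov : ∀ y ∈ Icc a b, ∃ i, ∃ x ∈ Icc a b, y = p i * x + h i := by
    intro y hy
    have hmem : (y, f y) ∈ {pt : ℝ × ℝ | ∃ x ∈ Icc a b, pt = (x, f x)} := ⟨y, hy, rfl⟩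
    rw [hattr] at hmem
    obtain ⟨i, _, ⟨x, hx, rfl⟩, hxy⟩ := mem_iUnion.1 hmem
    exact ⟨i, x, hx, (Prod.mk.inj hxy).1.symm⟩
  have hfcont : ContinuousOn f (Icc a b) := continuousOn_of_isCompact_graphOn hcompact
  have hgeq : ∀ n, ∃ Q R S : ℝ, ∀ x ∈ Icc a b, (g n).1 * x + (g n).2 ∈ Icc a b →
      f ((g n).1 * x + (g n).2) = f x + Q * f x + R * x + S := by
    intro n
    obtain ⟨u, v, -, -, hguv⟩ := hgF n
    obtain ⟨Qu, Ru, Su, -, hu⟩ := wordCoeff_functional_equation hq0 hS u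
    obtain ⟨Qv, Rv, Sv, hQv, hv⟩ := wordCoeff_functional_equation hq0 hS v
    refine ⟨Qu / Qv - 1, (Ru - Rv * (g n).1) / Qv, (Su - Sv - Rv * (g n).2) / Qv,
      fun x hx hgx => ?_⟩
    have e1 := (hu x hx).2
    have e2 := (hv _ hgx).2
    rw [← hguv, show (affComp (wordCoeff p h v) (g n)).1 * x +
      (affComp (wordCoeff p h v) (g n)).2 =
        (wordCoeff p h v).1 * ((g n).1 * x + (g n).2) + (wordCoeff p h v).2 by
      simp only [affComp]; ring, e2] at e1
    field_simp
    linear_combination e1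
  choose Q R S hQRS using hgeq
  let fe : ℝ → ℝ := IccExtend hab.le ((Icc a b).domRestrict f)
  have hfe : ∀ x ∈ Icc a b, fe x = f x := fun x hx => IccExtend_of_mem hab.le _ hx
  have hfecont : Continuous fe := (continuousOn_iff_continuous_domRestrict.1 hfcont).Icc_extend'
  let F : ℝ → ℝ := fun x => ∫ t in a..x, fe t
  have hF : ∀ x, HasDerivAt F (fe x) x := fun x =>
    (hfecont.integral_hasStrictDerivAt a x).hasDerivAt
  have hu0 : Tendsto (fun n => (g n).1 - 1) atTop (𝓝 0) := by
    simpa using hglin.sub_const 1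
  have hsmall : ∀ᶠ n in atTop,
      |(g n).1 - 1| * (|a| + |b|) + |(g n).2| < (b - a) / 3 := by
    have : Tendsto (fun n => |(g n).1 - 1| * (|a| + |b|) + |(g n).2|) atTop (𝓝 0) := by
      simpa using (hu0.abs.mul_const (|a| + |b|)).add hgconst.abs
    exact this.eventually_lt_const (by linarith)
  obtain ⟨N, hN⟩ := eventually_atTop.1 hsmall
  obtain ⟨α, β, A, r', s', k, hne, hode⟩ := exists_linear_equation_of_tendsto_id hF
    (c := a + (b - a) / 3) (d := b - (b - a) / 3)
    (hu0.comp (tendsto_add_atTop_nat N)) (hgconst.comp (tendsto_add_atTop_nat N))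
    (Q := fun n => Q (n + N)) (R := fun n => R (n + N)) (S := fun n => S (n + N))
    (fun n => by
      by_contra! hcon
      exact hgne (n + N) (Prod.ext (sub_eq_zero.1 hcon.1) hcon.2))
    (fun n x hx => by
      have hx' : x ∈ Icc a b := ⟨by linarith [hx.1], by linarith [hx.2]⟩
      have hxabs : |x| ≤ |a| + |b| := by
        rw [abs_le]
        constructor <;> linarith [hx'.1, hx'.2, neg_abs_le a, le_abs_self b, abs_nonneg a,
          abs_nonneg b]
      have hdelta : |((g (n + N)).1 - 1) * x + (g (n + N)).2| < (b - a) / 3 := by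
        refine ((abs_add_le _ _).trans ?_).trans_lt (hN (n + N) (Nat.le_add_left _ _))
        rw [abs_mul]
        gcongr
      rw [abs_lt] at hdelta
      have hgx : (g (n + N)).1 * x + (g (n + N)).2 ∈ Icc a b :=
        ⟨by linarith [hx.1], by linarith [hx.2]⟩
      simp only [Function.comp_apply]
      rw [show x + (((g (n + N)).1 - 1) * x + (g (n + N)).2) =
        (g (n + N)).1 * x + (g (n + N)).2 by ring, hfe _ hgx, hfe x hx']
      exact hQRS (n + N) x hx' hgx)
  obtain ⟨c, d, hc, hcd, hd, hsmooth⟩ :=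
    exists_contDiffOn_of_linear_equation hF (by linarith) hne hode
  obtain ⟨w, hw⟩ := exists_wordCoeff_small (fun i => (hp i).2) hcov
    (y := (c + d) / 2) ⟨by linarith, by linarith⟩ (ε := (d - c) / 2) (by linarith)
  obtain ⟨Qw, Rw, Sw, hQw, hweq⟩ := wordCoeff_functional_equation hq0 hS w
  refine quadratic_of_contDiffOn hab (fun i => ⟨hp0 i, (hp i).2⟩) hq0 hS hcov fun n => ?_
  have hcomp : ContDiffOn ℝ n
      (fun x => fe ((wordCoeff p h w).1 * x + (wordCoeff p h w).2)) (Icc a b) :=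
    (hsmooth n).comp (by fun_prop) fun x hx => by
      have := abs_lt.1 (hw x hx)
      exact ⟨by linarith, by linarith⟩
  have hquot : ContDiffOn ℝ n (fun x => (fe ((wordCoeff p h w).1 * x + (wordCoeff p h w).2) -
      Rw * x - Sw) / Qw) (Icc a b) :=
    ((hcomp.sub (by fun_prop)).sub contDiffOn_const).div_const Qw
  refine hquot.congr fun x hx => ?_
  obtain ⟨hmem, heq⟩ := hweq x hx
  rw [hfe _ hmem, heq]
  field_simp
  ring
end

section
/- Let a < b and a' < b' with [a',b'] ⊂ (a,b), and let M > 0. There exists a constant M' > 0 (depending only on a, b, a', b', M) such that: for every function φ ∈ C³([a,b]) satisfying |φ(x)| ≤ M for all x ∈ [a,b], and such that φ'' and φ''' are each monotone on [a,b] and each of constant sign on [a,b] (never changing sign), one has |φ(x)| ≤ M', |φ'(x)| ≤ M', |φ''(x)| ≤ M', and |φ'''(x)| ≤ M' for all x ∈ [a',b']. -/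
open Set

lemma exists_slope_eq_of_hasDerivWithinAt {p q x y : ℝ} {g g' : ℝ → ℝ}
    (hg : ∀ x ∈ Icc p q, HasDerivWithinAt g (g' x) (Icc p q) x)
    (hpx : p ≤ x) (hxy : x < y) (hyq : y ≤ q) :
    ∃ c ∈ Ioo x y, g y - g x = g' c * (y - x) := by
  have hsub : Icc x y ⊆ Icc p q := Icc_subset_Icc hpx hyq
  obtain ⟨c, hc, h⟩ := exists_hasDerivAt_eq_slope g g' hxy
    (fun z hz => ((hg z (hsub hz)).mono hsub).continuousWithinAt)
    (fun z hz => ((hg z (hsub (Ioo_subset_Icc_self hz))).mono hsub).hasDerivAt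
      (Icc_mem_nhds hz.1 hz.2))
  refine ⟨c, hc, ?_⟩
  have : y - x ≠ 0 := (sub_pos.2 hxy).ne'
  rw [h]
  field_simp

lemma monotoneOn_Icc_of_hasDerivWithinAt_nonneg {p q : ℝ} {g g' : ℝ → ℝ}
    (hg : ∀ x ∈ Icc p q, HasDerivWithinAt g (g' x) (Icc p q) x)
    (hpos : ∀ x ∈ Icc p q, 0 ≤ g' x) : MonotoneOn g (Icc p q) := by
  intro x hx y hy hxy
  rcases hxy.eq_or_lt with rfl | hlt
  · rfl
  obtain ⟨c, hc, h⟩ := exists_slope_eq_of_hasDerivWithinAt hg hx.1 hlt hy.2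
  have := mul_nonneg (hpos c ⟨hx.1.trans hc.1.le, hc.2.le.trans hy.2⟩) (sub_nonneg.2 hxy)
  linarith

lemma abs_deriv_le_of_monotoneOn {p q h K : ℝ} {g g' : ℝ → ℝ} (hh : 0 < h)
    (hg : ∀ x ∈ Icc p q, HasDerivWithinAt g (g' x) (Icc p q) x)
    (hK : ∀ x ∈ Icc p q, |g x| ≤ K) (hmono : MonotoneOn g' (Icc p q)) :
    ∀ x ∈ Icc (p + h) (q - h), |g' x| ≤ 2 * K / h := by
  rintro x ⟨hx₁, hx₂⟩
  have hx : x ∈ Icc p q := ⟨by linarith, by linarith⟩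
  obtain ⟨c, hc, hcs⟩ := exists_slope_eq_of_hasDerivWithinAt hg hx.1
    (by linarith : x < x + h) (by linarith)
  obtain ⟨d, hd, hds⟩ := exists_slope_eq_of_hasDerivWithinAt hg
    (by linarith : p ≤ x - h) (by linarith : x - h < x) hx.2
  have hxc : g' x ≤ g' c := hmono hx ⟨by linarith [hc.1], by linarith [hc.2]⟩ hc.1.le
  have hdx : g' d ≤ g' x := hmono ⟨by linarith [hd.1], by linarith [hd.2]⟩ hx hd.2.le
  have h₀ := abs_le.1 (hK x hx)
  have h₁ := abs_le.1 (hK (x + h) ⟨by linarith, by linarith⟩)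
  have h₂ := abs_le.1 (hK (x - h) ⟨by linarith, by linarith⟩)
  rw [le_div_iff₀ hh, ← abs_of_pos hh, ← abs_mul, abs_le]
  have hxc' := mul_le_mul_of_nonneg_right hxc hh.le
  have hdx' := mul_le_mul_of_nonneg_right hdx hh.le
  rw [add_sub_cancel_left] at hcs
  rw [sub_sub_cancel] at hds
  constructor <;> linarith

lemma abs_deriv_le_of_monotoneOn_or_antitoneOn {p q h K : ℝ} {g g' : ℝ → ℝ} (hh : 0 < h)
    (hg : ∀ x ∈ Icc p q, HasDerivWithinAt g (g' x) (Icc p q) x)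
    (hK : ∀ x ∈ Icc p q, |g x| ≤ K)
    (hmono : MonotoneOn g' (Icc p q) ∨ AntitoneOn g' (Icc p q)) :
    ∀ x ∈ Icc (p + h) (q - h), |g' x| ≤ 2 * K / h := by
  rcases hmono with hmono | hanti
  · exact abs_deriv_le_of_monotoneOn hh hg hK hmono
  · simpa using abs_deriv_le_of_monotoneOn (g := -g) (g' := -g') hh
      (fun x hx => (hg x hx).neg) (by simpa using hK) hanti.neg

/-- **Lemma 6.** Let `a < b`, `[a',b'] ⊂ (a,b)` and `M > 0`.  There is a constant
`M' > 0`, depending only on `a, b, a', b', M`, which bounds (on `[a',b']`) every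
`φ ∈ C³([a,b])` together with its first three derivatives, provided `|φ| ≤ M` on
`[a,b]` and `φ''`, `φ'''` are monotone and of constant sign on `[a,b]`. -/
theorem uniform_C3_bound (a b a' b' M : ℝ)
    (hab : a < b) (hab' : a' < b') (ha : a < a') (hb : b' < b) (hM : 0 < M) :
    ∃ M' : ℝ, 0 < M' ∧
      ∀ φ φ₁ φ₂ φ₃ : ℝ → ℝ,
        (∀ x ∈ Icc a b, HasDerivWithinAt φ (φ₁ x) (Icc a b) x) →
        (∀ x ∈ Icc a b, HasDerivWithinAt φ₁ (φ₂ x) (Icc a b) x) →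
        (∀ x ∈ Icc a b, HasDerivWithinAt φ₂ (φ₃ x) (Icc a b) x) →
        ContinuousOn φ₃ (Icc a b) →
        (∀ x ∈ Icc a b, |φ x| ≤ M) →
        (MonotoneOn φ₂ (Icc a b) ∨ AntitoneOn φ₂ (Icc a b)) →
        ((∀ x ∈ Icc a b, 0 ≤ φ₂ x) ∨ (∀ x ∈ Icc a b, φ₂ x ≤ 0)) →
        (MonotoneOn φ₃ (Icc a b) ∨ AntitoneOn φ₃ (Icc a b)) →
        ((∀ x ∈ Icc a b, 0 ≤ φ₃ x) ∨ (∀ x ∈ Icc a b, φ₃ x ≤ 0)) →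
        ∀ x ∈ Icc a' b',
          |φ x| ≤ M' ∧ |φ₁ x| ≤ M' ∧ |φ₂ x| ≤ M' ∧ |φ₃ x| ≤ M' := by
  obtain ⟨h, hh, hha, hhb⟩ : ∃ h : ℝ, 0 < h ∧ a + h + h + h ≤ a' ∧ b' ≤ b - h - h - h := by
    refine ⟨min (a' - a) (b - b') / 3, ?_, ?_, ?_⟩
    · have := lt_min (sub_pos.2 ha) (sub_pos.2 hb)
      positivity
    · linarith [min_le_left (a' - a) (b - b')]
    · linarith [min_le_right (a' - a) (b - b')]
  obtain ⟨K₁, hK₁⟩ : ∃ K, K = 2 * M / h := ⟨_, rfl⟩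
  obtain ⟨K₂, hK₂⟩ : ∃ K, K = 2 * K₁ / h := ⟨_, rfl⟩
  obtain ⟨K₃, hK₃⟩ : ∃ K, K = 2 * K₂ / h := ⟨_, rfl⟩
  have hK₁pos : 0 < K₁ := by rw [hK₁]; positivity
  have hK₂pos : 0 < K₂ := by rw [hK₂]; positivity
  have hK₃pos : 0 < K₃ := by rw [hK₃]; positivity
  refine ⟨M + K₁ + K₂ + K₃, by positivity, ?_⟩
  intro φ φ₁ φ₂ φ₃ h₁ h₂ h₃ _ hφ hmono₂ hsign₂ hmono₃ _ x hx
  have hmono₁ : MonotoneOn φ₁ (Icc a b) ∨ AntitoneOn φ₁ (Icc a b) := by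
    rcases hsign₂ with hs | hs
    · exact Or.inl (monotoneOn_Icc_of_hasDerivWithinAt_nonneg h₂ hs)
    · right
      have := monotoneOn_Icc_of_hasDerivWithinAt_nonneg (g := -φ₁) (g' := -φ₂)
        (fun x hx => (h₂ x hx).neg) (fun x hx => neg_nonneg.2 (hs x hx))
      simpa using this.neg
  have sub₁ : Icc (a + h) (b - h) ⊆ Icc a b :=
    Icc_subset_Icc (by linarith) (by linarith)
  have sub₂ : Icc (a + h + h) (b - h - h) ⊆ Icc (a + h) (b - h) :=
    Icc_subset_Icc (by linarith) (by linarith)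
  have sub₂' := sub₂.trans sub₁
  have bound₁ := abs_deriv_le_of_monotoneOn_or_antitoneOn hh h₁ hφ hmono₁
  rw [← hK₁] at bound₁
  have bound₂ := abs_deriv_le_of_monotoneOn_or_antitoneOn hh
    (fun x hx => (h₂ x (sub₁ hx)).mono sub₁) bound₁
    (hmono₂.imp (fun hm => hm.mono sub₁) (fun hm => hm.mono sub₁))
  rw [← hK₂] at bound₂
  have bound₃ := abs_deriv_le_of_monotoneOn_or_antitoneOn hh
    (fun x hx => (h₃ x (sub₂' hx)).mono sub₂') bound₂
    (hmono₃.imp (fun hm => hm.mono sub₂') (fun hm => hm.mono sub₂'))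
  rw [← hK₃] at bound₃
  have hx₃ : x ∈ Icc (a + h + h + h) (b - h - h - h) :=
    ⟨hha.trans hx.1, hx.2.trans hhb⟩
  have hx₂ : x ∈ Icc (a + h + h) (b - h - h) :=
    Icc_subset_Icc (by linarith) (by linarith) hx₃
  have e₀ := hφ x (sub₂' hx₂)
  have e₁ := bound₁ x (sub₂ hx₂)
  have e₂ := bound₂ x hx₂
  have e₃ := bound₃ x hx₃
  refine ⟨?_, ?_, ?_, ?_⟩ <;> linarith
end

section
/- Let M > 0 and λ ∈ (2^{-1/3}, 1). Let φ : [0,1] → ℝ be twice differentiable with |φ(x)| ≤ M for all x ∈ [0,1], with φ' monotone increasing on [0,1] (so φ'' ≥ 0), and with φ'' monotone on [0,1]. Then for every x ∈ [1−λ², λ²], one has 0 ≤ φ''(x) ≤ 4M/(λ(1−λ)²). -/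
open Set

/-- A function with nonnegative derivative on `[a, b]` does not decrease from `a` to `b`. -/
lemma le_of_hasDerivWithinAt_nonneg {g g' : ℝ → ℝ} {a b : ℝ} (hab : a ≤ b)
    (hg : ∀ s ∈ Icc a b, HasDerivWithinAt g (g' s) (Icc a b) s)
    (hg' : ∀ s ∈ Icc a b, 0 ≤ g' s) : g a ≤ g b :=
  monotoneOn_of_hasDerivWithinAt_nonneg (convex_Icc a b)
    (fun s hs => (hg s hs).continuousWithinAt)
    (fun s hs => (hg s (interior_subset hs)).mono interior_subset)
    (fun s hs => hg' s (interior_subset hs))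
    (left_mem_Icc.2 hab) (right_mem_Icc.2 hab) hab

/-- If `c ≤ f'` on `[a, b]`, then `c * (b - a) ≤ f b - f a`. -/
lemma mul_sub_le_of_le_hasDerivWithinAt {f f' : ℝ → ℝ} {a b c : ℝ} (hab : a ≤ b)
    (hf : ∀ s ∈ Icc a b, HasDerivWithinAt f (f' s) (Icc a b) s)
    (hc : ∀ s ∈ Icc a b, c ≤ f' s) : c * (b - a) ≤ f b - f a := by
  have h := le_of_hasDerivWithinAt_nonneg (g := fun s => f s - c * s)
    (g' := fun s => f' s - c * 1) hab
    (fun s hs => (hf s hs).sub ((hasDerivWithinAt_id s _).const_mul c))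
    (fun s hs => by linarith [hc s hs])
  linarith

lemma hasDerivWithinAt_quadratic (m c p s : ℝ) (S : Set ℝ) :
    HasDerivWithinAt (fun y => m * (y - p) + c / 2 * (y - p) ^ 2) (m + c * (s - p)) S s := by
  have h : HasDerivAt (fun y : ℝ => y - p) 1 s := (hasDerivAt_id s).sub_const p
  refine (((h.const_mul m).add ((h.pow 2).const_mul (c / 2))).congr_deriv ?_).hasDerivWithinAt
  push_cast
  ring

/-- Second-order Taylor lower bound at the left endpoint. -/
lemma taylor_lower_bound_left {f f' f'' : ℝ → ℝ} {a b c : ℝ} (hab : a ≤ b)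
    (hf : ∀ s ∈ Icc a b, HasDerivWithinAt f (f' s) (Icc a b) s)
    (hf' : ∀ s ∈ Icc a b, HasDerivWithinAt f' (f'' s) (Icc a b) s)
    (hc : ∀ s ∈ Icc a b, c ≤ f'' s) :
    f a + f' a * (b - a) + c / 2 * (b - a) ^ 2 ≤ f b := by
  have h := le_of_hasDerivWithinAt_nonneg hab
    (fun s hs => (hf s hs).sub (hasDerivWithinAt_quadratic (f' a) c a s _))
    (fun s hs => by
      have hsub : Icc a s ⊆ Icc a b := Icc_subset_Icc_right hs.2
      linarith [mul_sub_le_of_le_hasDerivWithinAt hs.1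
        (fun t ht => (hf' t (hsub ht)).mono hsub) (fun t ht => hc t (hsub ht))])
  simp only [Pi.sub_apply] at h
  linarith

/-- Second-order Taylor lower bound at the right endpoint. -/
lemma taylor_lower_bound_right {f f' f'' : ℝ → ℝ} {a b c : ℝ} (hab : a ≤ b)
    (hf : ∀ s ∈ Icc a b, HasDerivWithinAt f (f' s) (Icc a b) s)
    (hf' : ∀ s ∈ Icc a b, HasDerivWithinAt f' (f'' s) (Icc a b) s)
    (hc : ∀ s ∈ Icc a b, c ≤ f'' s) :
    f b + f' b * (a - b) + c / 2 * (a - b) ^ 2 ≤ f a := by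
  have h := le_of_hasDerivWithinAt_nonneg hab
    (fun s hs => (hasDerivWithinAt_quadratic (f' b) c b s _).sub (hf s hs))
    (fun s hs => by
      have hsub : Icc s b ⊆ Icc a b := Icc_subset_Icc_left hs.1
      linarith [mul_sub_le_of_le_hasDerivWithinAt hs.2
        (fun t ht => (hf' t (hsub ht)).mono hsub) (fun t ht => hc t (hsub ht))])
  simp only [Pi.sub_apply] at h
  linarith

lemma mul_one_sub_sq_le {l x : ℝ} (hl₀ : 0 < l) (hl₁ : l < 1)
    (hx : x ∈ Icc (1 - l ^ 2) (l ^ 2)) : l * (1 - l) ^ 2 ≤ x * (1 - x) ^ 2 := by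
  obtain ⟨hx₁, hx₂⟩ := hx
  have hpos : 0 < 1 - l ^ 2 := by nlinarith
  rcases le_total x (1 / 2) with h | h
  · calc l * (1 - l) ^ 2 ≤ (1 - l ^ 2) * (1 / 2) ^ 2 := by
          nlinarith [mul_nonneg (sub_pos.2 hl₁).le (sq_nonneg (2 * l - 1)),
            mul_pos hl₀ (sub_pos.2 hl₁)]
      _ ≤ x * (1 - x) ^ 2 := by gcongr; all_goals linarith
  · calc l * (1 - l) ^ 2 ≤ (1 / 2) * (1 - l ^ 2) ^ 2 := by
          nlinarith [mul_nonneg (sq_nonneg (1 - l)) (sq_nonneg l), sq_nonneg (1 - l)]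
      _ ≤ x * (1 - x) ^ 2 := by gcongr

/-- **Second step of Lemma 6.** Let `M > 0` and `λ ∈ (2^{-1/3}, 1)`.  If
`φ : [0,1] → ℝ` is twice differentiable with `|φ| ≤ M` on `[0,1]`, `φ'` monotone
increasing on `[0,1]` and `φ''` monotone on `[0,1]`, then for every
`x ∈ [1−λ², λ²]` one has `0 ≤ φ''(x) ≤ 4M/(λ(1−λ)²)`. -/
theorem second_deriv_bound (M l : ℝ) (hM : 0 < M)
    (hl₁ : (2 : ℝ) ^ (-(1 : ℝ) / 3) < l) (hl₂ : l < 1)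
    (φ φ' φ'' : ℝ → ℝ)
    (hderiv : ∀ x ∈ Icc (0 : ℝ) 1, HasDerivWithinAt φ (φ' x) (Icc (0 : ℝ) 1) x)
    (hderiv' : ∀ x ∈ Icc (0 : ℝ) 1, HasDerivWithinAt φ' (φ'' x) (Icc (0 : ℝ) 1) x)
    (hbound : ∀ x ∈ Icc (0 : ℝ) 1, |φ x| ≤ M)
    (hmono : MonotoneOn φ' (Icc (0 : ℝ) 1))
    (hmono'' : MonotoneOn φ'' (Icc (0 : ℝ) 1) ∨ AntitoneOn φ'' (Icc (0 : ℝ) 1)) :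
    ∀ x ∈ Icc (1 - l ^ 2) (l ^ 2),
      0 ≤ φ'' x ∧ φ'' x ≤ 4 * M / (l * (1 - l) ^ 2) := by
  intro x hx
  have hl₀ : 0 < l := (Real.rpow_pos_of_pos two_pos _).trans hl₁
  have hx₀ : 0 ≤ x := by nlinarith [hx.1]
  have hx₁ : x ≤ 1 := by nlinarith [hx.2]
  have hxI : x ∈ Icc (0 : ℝ) 1 := ⟨hx₀, hx₁⟩
  have hnonneg : ∀ s ∈ Icc (0 : ℝ) 1, 0 ≤ φ'' s := fun s hs => by
    rw [← (hderiv' s hs).derivWithin (uniqueDiffOn_Icc one_pos s hs)]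
    exact hmono.derivWithin_nonneg
  refine ⟨hnonneg x hxI, ?_⟩
  have hL : Icc 0 x ⊆ Icc (0 : ℝ) 1 := Icc_subset_Icc_right hx₁
  have hR : Icc x 1 ⊆ Icc (0 : ℝ) 1 := Icc_subset_Icc_left hx₀
  have taylor_one {c : ℝ} := taylor_lower_bound_left (c := c) hx₁
    (fun s hs => (hderiv s (hR hs)).mono hR) (fun s hs => (hderiv' s (hR hs)).mono hR)
  have taylor_zero {c : ℝ} := taylor_lower_bound_right (c := c) hx₀
    (fun s hs => (hderiv s (hL hs)).mono hL) (fun s hs => (hderiv' s (hL hs)).mono hL)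
  have hb₀ := (abs_le.1 (hbound 0 (left_mem_Icc.2 zero_le_one))).2
  have hb₁ := (abs_le.1 (hbound 1 (right_mem_Icc.2 zero_le_one))).2
  have hbx := (abs_le.1 (hbound x hxI)).1
  rw [le_div_iff₀ (mul_pos hl₀ (pow_pos (sub_pos.2 hl₂) 2))]
  rcases hmono'' with hm | hm
  · have h₁ := taylor_one fun s hs => hm hxI (hR hs) hs.1
    have h₀ := taylor_zero fun s hs => hnonneg s (hL hs)
    have hlow := mul_le_mul_of_nonneg_left (mul_one_sub_sq_le hl₀ hl₂ hx) (hnonneg x hxI)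
    linarith [mul_le_mul_of_nonneg_left (h₁.trans hb₁) hx₀,
      mul_le_mul_of_nonneg_left (h₀.trans hb₀) (sub_nonneg.2 hx₁)]
  · have h₁ := taylor_one fun s hs => hnonneg s (hR hs)
    have h₀ := taylor_zero fun s hs => hm (hL hs) hxI hs.2
    have hx' : 1 - x ∈ Icc (1 - l ^ 2) (l ^ 2) := ⟨by linarith [hx.2], by linarith [hx.1]⟩
    have hlow := mul_le_mul_of_nonneg_left (mul_one_sub_sq_le hl₀ hl₂ hx') (hnonneg x hxI)
    linarith [mul_le_mul_of_nonneg_left (h₁.trans hb₁) hx₀,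
      mul_le_mul_of_nonneg_left (h₀.trans hb₀) (sub_nonneg.2 hx₁)]
end

section
/- Let f : [a,b] → ℝ be a continuous function with graph Γ(f) = {(x, f(x)) : x ∈ [a,b]}, and let g(x,y) = (p x + h, q y + r x + s) be an affine map of the plane with projection g^◊(x) = p x + h. Let ε > 0 and δ > 0. Assume: (i) for all x₁, x₂ ∈ [a,b] with |x₁ − x₂| < δ, the distance between (x₁, f(x₁)) and (x₂, f(x₂)) is less than ε; (ii) ‖g(x,y) − (x,y)‖ < δ for every point (x,y) ∈ Γ(f); (iii) g^◊ has no fixed point in [a,b]; (iv) for every x ∈ [a,b] with g^◊(x) ∈ [a,b], g(x, f(x)) = (g^◊(x), f(g^◊(x))). Then there exists M ∈ ℕ such that either the finite set {gⁿ(a, f(a)) : n = 0,...,M} or the finite set {gⁿ(b, f(b)) : n = 0,...,M} is an ε-net in Γ(f). -/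
open Set

/-- Euclidean distance on the plane `ℝ × ℝ`. -/
noncomputable def dist2 (u v : ℝ × ℝ) : ℝ :=
  Real.sqrt ((u.1 - v.1) ^ 2 + (u.2 - v.2) ^ 2)

/-- A continuous nonvanishing function on a compact interval is bounded away from zero
with a constant sign. -/
theorem exists_pos_le_or_le_neg_of_ne_zero {a b : ℝ} (hab : a ≤ b) {ψ : ℝ → ℝ}
    (hψ : ContinuousOn ψ (Icc a b)) (h0 : ∀ x ∈ Icc a b, ψ x ≠ 0) :
    ∃ c > 0, (∀ x ∈ Icc a b, c ≤ ψ x) ∨ (∀ x ∈ Icc a b, c ≤ -ψ x) := by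
  obtain ⟨m, hm, hmin⟩ := isCompact_Icc.exists_isMinOn (nonempty_Icc.2 hab) hψ
  obtain ⟨t, ht, hmax⟩ := isCompact_Icc.exists_isMaxOn (nonempty_Icc.2 hab) hψ
  rcases (h0 m hm).lt_or_gt with hneg | hpos
  · rcases (h0 t ht).lt_or_gt with htneg | htpos
    · exact ⟨-ψ t, neg_pos.2 htneg, Or.inr fun x hx => neg_le_neg (hmax hx)⟩
    · obtain ⟨x, hx, hx0⟩ := isPreconnected_Icc.intermediate_value hm ht hψ
        ⟨hneg.le, htpos.le⟩
      exact absurd hx0 (h0 x hx)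
  · exact ⟨ψ m, hpos, Or.inl fun x hx => hmin hx⟩

/-- If a map of the plane moves points of a graph over `[a, b]` along the graph, in the direction
`σ = ±1`, with horizontal steps at least `c` and less than `δ`, then before
completing `n` steps the orbit of `(e, f e)` comes `δ`-close to the abscissa `x`, or else it
has advanced by at least `n * c` without passing `x`. -/
theorem exists_iterate_near_or_advance {a b c δ e x σ : ℝ} {f φ : ℝ → ℝ}
    {g : ℝ × ℝ → ℝ × ℝ} (hc : 0 ≤ c) (hσ : σ = 1 ∨ σ = -1)
    (hstep : ∀ u ∈ Icc a b, c ≤ σ * (φ u - u)) (hδ : ∀ u ∈ Icc a b, |φ u - u| < δ)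
    (hg : ∀ u ∈ Icc a b, φ u ∈ Icc a b → g (u, f u) = (φ u, f (φ u)))
    (he : e ∈ Icc a b) (hx : x ∈ Icc a b) (hex : 0 ≤ σ * (x - e)) (n : ℕ) :
    (∃ k < n, ∃ u ∈ Icc a b, g^[k] (e, f e) = (u, f u) ∧ |x - u| < δ) ∨
      ∃ u ∈ Icc a b, g^[n] (e, f e) = (u, f u) ∧ 0 ≤ σ * (x - u) ∧ n * c ≤ σ * (u - e) := by
  induction n with
  | zero => exact Or.inr ⟨e, he, rfl, hex, by simp⟩
  | succ n ih =>
    rcases ih with ⟨k, hk, hu⟩ | ⟨u, hu, hgu, hxu, hn⟩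
    · exact Or.inl ⟨k, hk.trans n.lt_succ_self, hu⟩
    have hsu := hstep u hu
    by_cases hpass : σ * (x - φ u) < 0
    · refine Or.inl ⟨n, n.lt_succ_self, u, hu, hgu, ?_⟩
      have hd := abs_lt.1 (hδ u hu)
      rcases hσ with rfl | rfl <;> exact abs_lt.2 ⟨by linarith, by linarith⟩
    · have hmem : φ u ∈ Icc a b := by
        rcases hσ with rfl | rfl <;> exact ⟨by linarith [hu.1, hx.1], by linarith [hu.2, hx.2]⟩
      refine Or.inr ⟨φ u, hmem, ?_, not_lt.1 hpass, ?_⟩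
      · rw [Function.iterate_succ_apply', hgu, hg u hu hmem]
      · push_cast
        linarith

/-- Under the step hypotheses of `exists_iterate_near_or_advance`, with steps bounded away from
zero, finitely many points of the orbit of `(e, f e)` come `δ`-close to every abscissa of
`[a, b]` lying in the direction `σ` from `e`. -/
theorem exists_forall_iterate_near {a b c δ e σ : ℝ} {f φ : ℝ → ℝ}
    {g : ℝ × ℝ → ℝ × ℝ} (hc : 0 < c) (hσ : σ = 1 ∨ σ = -1)
    (hstep : ∀ u ∈ Icc a b, c ≤ σ * (φ u - u)) (hδ : ∀ u ∈ Icc a b, |φ u - u| < δ)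
    (hg : ∀ u ∈ Icc a b, φ u ∈ Icc a b → g (u, f u) = (φ u, f (φ u)))
    (he : e ∈ Icc a b) (hex : ∀ x ∈ Icc a b, 0 ≤ σ * (x - e)) :
    ∃ M : ℕ, ∀ x ∈ Icc a b, ∃ n ≤ M, ∃ u ∈ Icc a b,
      g^[n] (e, f e) = (u, f u) ∧ |x - u| < δ := by
  obtain ⟨M, hM⟩ := exists_nat_gt ((b - a) / c)
  rw [div_lt_iff₀ hc] at hM
  refine ⟨M, fun x hx => ?_⟩
  rcases exists_iterate_near_or_advance hc.le hσ hstep hδ hg he hx (hex x hx) M with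
    ⟨n, hn, hu⟩ | ⟨u, hu, -, -, hadv⟩
  · exact ⟨n, hn.le, hu⟩
  · exfalso
    rcases hσ with rfl | rfl <;> linarith [hu.1, hu.2, he.1, he.2]

theorem abs_fst_sub_le_dist2 (u v : ℝ × ℝ) : |u.1 - v.1| ≤ dist2 u v :=
  Real.abs_le_sqrt (le_add_of_nonneg_right (sq_nonneg _))

/-- **Lemma 7.** Let `f : [a,b] → ℝ` be continuous, `g(x,y) = (p·x + h, q·y + r·x + s)`
an affine map of the plane with projection `g^◊(x) = p·x + h`, and `ε, δ > 0`.
Assume: (i) points of the graph over `δ`-close abscissas are `ε`-close; (ii) `g` moves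
every point of the graph by less than `δ`; (iii) `g^◊` has no fixed point in `[a,b]`;
(iv) `g` moves points of the graph along the graph.  Then for some `M ∈ ℕ`, either
`{gⁿ(a, f a) : n = 0,…,M}` or `{gⁿ(b, f b) : n = 0,…,M}` is an `ε`-net in the graph. -/
theorem orbit_eps_net (a b ε δ p h q r s : ℝ) (hab : a < b) (hε : 0 < ε) (hδ : 0 < δ)
    (f : ℝ → ℝ) (hf : ContinuousOn f (Icc a b))
    (g : ℝ × ℝ → ℝ × ℝ)
    (hg : g = fun pt => (p * pt.1 + h, q * pt.2 + r * pt.1 + s))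
    (hi : ∀ x₁ ∈ Icc a b, ∀ x₂ ∈ Icc a b,
      |x₁ - x₂| < δ → dist2 (x₁, f x₁) (x₂, f x₂) < ε)
    (hii : ∀ x ∈ Icc a b, dist2 (g (x, f x)) (x, f x) < δ)
    (hiii : ∀ x ∈ Icc a b, p * x + h ≠ x)
    (hiv : ∀ x ∈ Icc a b, p * x + h ∈ Icc a b →
      g (x, f x) = (p * x + h, f (p * x + h))) :
    ∃ M : ℕ,
      (∀ x ∈ Icc a b, ∃ n ≤ M, dist2 (x, f x) (g^[n] (a, f a)) ≤ ε) ∨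
      (∀ x ∈ Icc a b, ∃ n ≤ M, dist2 (x, f x) (g^[n] (b, f b)) ≤ ε) := by
  have hδ' : ∀ u ∈ Icc a b, |p * u + h - u| < δ := fun u hu => by
    have hu' := hii u hu
    rw [hg] at hu'
    exact (abs_fst_sub_le_dist2 _ _).trans_lt hu'
  have hnet : ∀ e, (∃ M : ℕ, ∀ x ∈ Icc a b, ∃ n ≤ M, ∃ u ∈ Icc a b,
      g^[n] (e, f e) = (u, f u) ∧ |x - u| < δ) →
      ∃ M : ℕ, ∀ x ∈ Icc a b, ∃ n ≤ M, dist2 (x, f x) (g^[n] (e, f e)) ≤ ε := by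
    rintro e ⟨M, hM⟩
    refine ⟨M, fun x hx => ?_⟩
    obtain ⟨n, hn, u, hu, hgu, hxu⟩ := hM x hx
    exact ⟨n, hn, hgu ▸ (hi x hx u hu hxu).le⟩
  obtain ⟨c, hc, hpos | hneg⟩ := exists_pos_le_or_le_neg_of_ne_zero hab.le
    (ψ := fun x => p * x + h - x) (by fun_prop) (fun x hx => sub_ne_zero.2 (hiii x hx))
  · obtain ⟨M, hM⟩ := hnet a <| exists_forall_iterate_near (σ := 1) hc (Or.inl rfl)
      (by simpa using hpos) hδ' hiv (left_mem_Icc.2 hab.le)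
      (fun x hx => by linarith [hx.1])
    exact ⟨M, Or.inl hM⟩
  · obtain ⟨M, hM⟩ := hnet b <| exists_forall_iterate_near (σ := -1) hc (Or.inr rfl)
      (fun u hu => by linarith [hneg u hu]) hδ' hiv (right_mem_Icc.2 hab.le)
      (fun x hx => by linarith [hx.2])
    exact ⟨M, Or.inr hM⟩
end

section
/- Let g(x,y) = (x + h, q y + r x + s) be an affine map of the plane with h ≠ 0, q > 0 and q ≠ 1, and set K = (ln q)/h. Then there exist real constants A and B such that all the points gⁿ(0,0), n ∈ ℕ, lie on the curve y = A x + B (e^{K x} − 1); that is, for every n ∈ ℕ, if (xₙ, yₙ) = gⁿ(0,0), then yₙ = A xₙ + B (e^{K xₙ} − 1). -/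
/-- **Lemma 8, case 2.** If `g(x,y) = (x + h, q·y + r·x + s)` with `h ≠ 0`, `q > 0`,
`q ≠ 1`, and `K = (ln q)/h`, then there are real constants `A`, `B` such that all the
points `gⁿ(0,0)` lie on the curve `y = A·x + B·(e^{K·x} − 1)`. -/
theorem orbit_on_exponential_curve (h q r s : ℝ) (hh : h ≠ 0) (hq0 : 0 < q) (hq1 : q ≠ 1)
    (K : ℝ) (hK : K = Real.log q / h)
    (g : ℝ × ℝ → ℝ × ℝ)
    (hg : g = fun pt => (pt.1 + h, q * pt.2 + r * pt.1 + s)) :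
    ∃ A B : ℝ, ∀ n : ℕ,
      (g^[n] (0, 0)).2 =
        A * (g^[n] (0, 0)).1 + B * (Real.exp (K * (g^[n] (0, 0)).1) - 1) := by
  have hq : 1 - q ≠ 0 := sub_ne_zero.mpr hq1.symm
  have hexp (x : ℝ) : Real.exp (K * (x + h)) = q * Real.exp (K * x) := by
    have hKh : K * h = Real.log q := by rw [hK, div_mul_cancel₀ _ hh]
    rw [mul_add, Real.exp_add, hKh, Real.exp_log hq0, mul_comm]
  obtain ⟨A, hA⟩ : ∃ A : ℝ, A * (1 - q) = r := ⟨r / (1 - q), div_mul_cancel₀ _ hq⟩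
  obtain ⟨B, hB⟩ : ∃ B : ℝ, B * (1 - q) = A * h - s :=
    ⟨(A * h - s) / (1 - q), div_mul_cancel₀ _ hq⟩
  refine ⟨A, B, fun n => ?_⟩
  induction n with
  | zero => simp
  | succ n ih =>
    rw [Function.iterate_succ_apply']
    generalize g^[n] (0, 0) = p at ih ⊢
    simp only [hg, hexp]
    linear_combination q * ih - p.1 * hA + hB
end

section
/- Let g(x,y) = (p x + h, y + r x + s) be an affine map of the plane with p > 0, p ≠ 1, and h ≠ 0, and set C = h/(p − 1). Then 1 + xₙ/C > 0 for all n, and there exist real constants A and B such that all the points gⁿ(0,0), n ∈ ℕ, lie on the curve y = A x + B ln(1 + x/C); that is, for every n ∈ ℕ, if (xₙ, yₙ) = gⁿ(0,0), then yₙ = A xₙ + B ln(1 + xₙ/C). -/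
/-- Closed form for the orbit of the origin under `(x, y) ↦ (p x + (p - 1) C, y + r x + s)`. -/
theorem iterate_shear_affine_origin {p : ℝ} (hp1 : p ≠ 1) (C r s : ℝ) (n : ℕ) :
    (fun pt : ℝ × ℝ => (p * pt.1 + (p - 1) * C, pt.2 + r * pt.1 + s))^[n] (0, 0) =
      (C * (p ^ n - 1), r / (p - 1) * (C * (p ^ n - 1)) + n * (s - r * C)) := by
  have hp : p - 1 ≠ 0 := sub_ne_zero.mpr hp1
  induction n with
  | zero => simp
  | succ n ih =>
    rw [Function.iterate_succ_apply', ih]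
    ext
    · ring
    · push_cast
      field_simp
      ring

/-- **Lemma 8, case 3.** If `g(x,y) = (p·x + h, y + r·x + s)` with `p > 0`, `p ≠ 1`,
`h ≠ 0`, and `C = h/(p − 1)`, then `1 + xₙ/C > 0` for all `n`, and there are real
constants `A`, `B` such that all the points `gⁿ(0,0)` lie on the curve
`y = A·x + B·ln(1 + x/C)`. -/
theorem orbit_on_log_curve (p h r s : ℝ) (hp0 : 0 < p) (hp1 : p ≠ 1) (hh : h ≠ 0)
    (C : ℝ) (hC : C = h / (p - 1))
    (g : ℝ × ℝ → ℝ × ℝ)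
    (hg : g = fun pt => (p * pt.1 + h, pt.2 + r * pt.1 + s)) :
    (∀ n : ℕ, 0 < 1 + (g^[n] (0, 0)).1 / C) ∧
    ∃ A B : ℝ, ∀ n : ℕ,
      (g^[n] (0, 0)).2 =
        A * (g^[n] (0, 0)).1 + B * Real.log (1 + (g^[n] (0, 0)).1 / C) := by
  have hp : p - 1 ≠ 0 := sub_ne_zero.mpr hp1
  have hC0 : C ≠ 0 := hC ▸ div_ne_zero hh hp
  obtain rfl : h = (p - 1) * C := by rw [hC]; field_simp
  have orbit : ∀ n : ℕ, g^[n] (0, 0) =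
      (C * (p ^ n - 1), r / (p - 1) * (C * (p ^ n - 1)) + n * (s - r * C)) :=
    fun n => hg ▸ iterate_shear_affine_origin hp1 C r s n
  have hpow : ∀ n : ℕ, 1 + (g^[n] (0, 0)).1 / C = p ^ n := fun n => by
    rw [orbit]
    field_simp
    ring
  refine ⟨fun n => hpow n ▸ pow_pos hp0 n, r / (p - 1), (s - r * C) / Real.log p, fun n => ?_⟩
  have hlog : Real.log p ≠ 0 := Real.log_ne_zero_of_pos_of_ne_one hp0 hp1
  rw [hpow, orbit, Real.log_pow]
  field_simp
end

section
/- Let g(x,y) = (p x + h, q y + r x + s) be an affine map of the plane with p > 0, q > 0, p ≠ 1, q ≠ 1, p ≠ q, and h ≠ 0. Set C = h/(p − 1) and K = (ln q)/(ln p). Then 1 + xₙ/C > 0 for all n, and there exist real constants A and B such that all the points gⁿ(0,0), n ∈ ℕ, lie on the curve y = A x + B ((1 + x/C)^K − 1); that is, for every n ∈ ℕ, if (xₙ, yₙ) = gⁿ(0,0), then yₙ = A xₙ + B ((1 + xₙ/C)^K − 1). -/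
/-- The orbit of the origin under a triangular affine map of the plane, in closed form. -/
theorem affine_iterate_origin {p q r s C A B : ℝ} (hA : A * (p - q) = r)
    (hB : (A * C + B) * (q - 1) = s - r * C) (n : ℕ) :
    (fun pt : ℝ × ℝ => (p * pt.1 + C * (p - 1), q * pt.2 + r * pt.1 + s))^[n] (0, 0) =
      (C * (p ^ n - 1), A * (C * (p ^ n - 1)) + B * (q ^ n - 1)) := by
  induction n with
  | zero => simp
  | succ n ih =>
    rw [Function.iterate_succ_apply', ih]
    ext
    · simp only
      ring
    · simp only
      linear_combination -C * p ^ n * hA - hB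

/-- Raising a power of `p` to the exponent `log q / log p` gives the same power of `q`. -/
theorem pow_rpow_log_div_log {p q : ℝ} (hp0 : 0 < p) (hp1 : p ≠ 1) (hq0 : 0 < q) (n : ℕ) :
    (p ^ n) ^ (Real.log q / Real.log p) = q ^ n := by
  have hlog : Real.log p ≠ 0 := Real.log_ne_zero_of_pos_of_ne_one hp0 hp1
  rw [← Real.rpow_natCast_mul hp0.le, mul_comm, Real.rpow_mul_natCast hp0.le,
    Real.rpow_def_of_pos hp0, mul_div_cancel₀ _ hlog, Real.exp_log hq0]

/-- **Lemma 8, case 4.** If `g(x,y) = (p·x + h, q·y + r·x + s)` with `p, q > 0`,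
`p ≠ 1`, `q ≠ 1`, `p ≠ q`, `h ≠ 0`, `C = h/(p − 1)` and `K = (ln q)/(ln p)`, then
`1 + xₙ/C > 0` for all `n`, and there are real constants `A`, `B` such that all the
points `gⁿ(0,0)` lie on the curve `y = A·x + B·((1 + x/C)^K − 1)`. -/
theorem orbit_on_power_curve (p q h r s : ℝ) (hp0 : 0 < p) (hq0 : 0 < q)
    (hp1 : p ≠ 1) (hq1 : q ≠ 1) (hpq : p ≠ q) (hh : h ≠ 0)
    (C K : ℝ) (hC : C = h / (p - 1)) (hK : K = Real.log q / Real.log p)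
    (g : ℝ × ℝ → ℝ × ℝ)
    (hg : g = fun pt => (p * pt.1 + h, q * pt.2 + r * pt.1 + s)) :
    (∀ n : ℕ, 0 < 1 + (g^[n] (0, 0)).1 / C) ∧
    ∃ A B : ℝ, ∀ n : ℕ,
      (g^[n] (0, 0)).2 =
        A * (g^[n] (0, 0)).1 +
          B * ((1 + (g^[n] (0, 0)).1 / C) ^ K - 1) := by
  have hp : p - 1 ≠ 0 := sub_ne_zero.2 hp1
  have hq : q - 1 ≠ 0 := sub_ne_zero.2 hq1
  have hd : p - q ≠ 0 := sub_ne_zero.2 hpq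
  have hC0 : C ≠ 0 := hC ▸ div_ne_zero hh hp
  have hhC : h = C * (p - 1) := by rw [hC, div_mul_cancel₀ _ hp]
  have orbit (n : ℕ) := affine_iterate_origin (p := p) (q := q) (r := r) (s := s) (C := C)
    (A := r / (p - q)) (B := (s - r * C) / (q - 1) - r / (p - q) * C)
    (div_mul_cancel₀ _ hd) (by rw [add_sub_cancel, div_mul_cancel₀ _ hq]) n
  have base (n : ℕ) : 1 + C * (p ^ n - 1) / C = p ^ n := by
    rw [mul_div_cancel_left₀ _ hC0, add_sub_cancel]
  subst hg
  rw [hhC]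
  refine ⟨fun n => ?_, r / (p - q), (s - r * C) / (q - 1) - r / (p - q) * C, fun n => ?_⟩
  · rw [orbit, base]
    exact pow_pos hp0 n
  · rw [orbit, base, hK, pow_rpow_log_div_log hp0 hp1 hq0]
end

section
/- Let g(x,y) = (p x + h, p y + r x + s) be an affine map of the plane with p > 0, p ≠ 1, and h ≠ 0, and set C = h/(p − 1). Then 1 + xₙ/C > 0 for all n, and there exist real constants A and B such that all the points gⁿ(0,0), n ∈ ℕ, lie on the curve y = A (1 + x/C) ln(1 + x/C) + B x; that is, for every n ∈ ℕ, if (xₙ, yₙ) = gⁿ(0,0), then yₙ = A (1 + xₙ/C) ln(1 + xₙ/C) + B xₙ. -/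
/-- **Lemma 8, case 5.** If `g(x,y) = (p·x + h, p·y + r·x + s)` with `p > 0`, `p ≠ 1`,
`h ≠ 0` and `C = h/(p − 1)`, then `1 + xₙ/C > 0` for all `n`, and there are real
constants `A`, `B` such that all the points `gⁿ(0,0)` lie on the curve
`y = A·(1 + x/C)·ln(1 + x/C) + B·x`. -/
theorem orbit_on_xlogx_curve (p h r s : ℝ) (hp0 : 0 < p) (hp1 : p ≠ 1) (hh : h ≠ 0)
    (C : ℝ) (hC : C = h / (p - 1))
    (g : ℝ × ℝ → ℝ × ℝ)
    (hg : g = fun pt => (p * pt.1 + h, p * pt.2 + r * pt.1 + s)) :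
    (∀ n : ℕ, 0 < 1 + (g^[n] (0, 0)).1 / C) ∧
    ∃ A B : ℝ, ∀ n : ℕ,
      (g^[n] (0, 0)).2 =
        A * (1 + (g^[n] (0, 0)).1 / C) * Real.log (1 + (g^[n] (0, 0)).1 / C) +
          B * (g^[n] (0, 0)).1 := by
  have hp1' : p - 1 ≠ 0 := sub_ne_zero.mpr hp1
  have hC0 : C ≠ 0 := by rw [hC]; exact div_ne_zero hh hp1'
  have hCh : h = C * (p - 1) := by rw [hC]; field_simp
  have hlog : Real.log p ≠ 0 := Real.log_ne_zero_of_pos_of_ne_one hp0 hp1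
  have orbit : ∀ n : ℕ, g^[n] (0, 0) =
      (C * (p ^ n - 1), r * C / p * n * p ^ n + (s - r * C) / (p - 1) * (p ^ n - 1)) := by
    intro n
    induction n with
    | zero => simp
    | succ n ih =>
      rw [Function.iterate_succ_apply', ih, hg]
      ext
      · simp only [hCh]
        ring
      · push_cast
        field_simp
        ring
  have hpow : ∀ n : ℕ, 1 + (g^[n] (0, 0)).1 / C = p ^ n := by
    intro n
    rw [orbit n]
    field_simp
    ring
  refine ⟨fun n => by rw [hpow n]; positivity,
    r * C / p / Real.log p, (s - r * C) / (p - 1) / C, fun n => ?_⟩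
  rw [hpow n, orbit n, Real.log_pow]
  field_simp
end
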